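/- Let K be a finite field of characteristic different from 2, K̄ an algebraic closure of K, and n ≥ 2 an even integer. Then the normaliser of Sp_n(K) in GSp_n(K̄) is contained in GSp_n(K)·K̄^×: every A ∈ GSp_n(K̄) with A·Sp_n(K)·A⁻¹ = Sp_n(K) can be written as A = λ·B with λ ∈ K̄^× and B ∈ GSp_n(K). -/

import Mathlib

open Matrix

noncomputable section

/-- The Gram matrix of the standard symplectic form on `R^n` (for `n` even):
block form `[[0, I], [-I, 0]]`. -/
def stdJ (n : ℕ) (R : Type*) [CommRing R] : Matrix (Fin n) (Fin n) R :=
  Matrix.of fun i j =>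
    if i.val + n / 2 = j.val then 1 else if j.val + n / 2 = i.val then -1 else 0

/-- `Sp_n(K)` viewed inside `GL_n(K̄)`: invertible matrices with entries in (the image
of) `K` satisfying `AᵀJA = J`. -/
def SpOver (K : Type*) [Field K] (n : ℕ) :
    Set (Matrix (Fin n) (Fin n) (AlgebraicClosure K))ˣ :=
  {A | (∀ i j, ∃ b : K, algebraMap K (AlgebraicClosure K) b
          = (A : Matrix (Fin n) (Fin n) (AlgebraicClosure K)) i j) ∧
    (A : Matrix (Fin n) (Fin n) (AlgebraicClosure K))ᵀ * stdJ n (AlgebraicClosure K)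
      * (A : Matrix (Fin n) (Fin n) (AlgebraicClosure K))
      = stdJ n (AlgebraicClosure K)}

theorem stdJ_apply_mem {L : Type*} [CommRing L] (S : Subring L) {n : ℕ} (i j : Fin n) :
    stdJ n L i j ∈ S := by
  simp only [stdJ, of_apply]
  split_ifs
  · exact S.one_mem
  · exact S.neg_mem S.one_mem
  · exact S.zero_mem

theorem stdJ_transpose (n : ℕ) (hn : Even n) (R : Type*) [CommRing R] :
    (stdJ n R)ᵀ = -stdJ n R := by
  obtain ⟨m, rfl⟩ := hn
  ext i j
  rw [Matrix.neg_apply]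
  simp only [stdJ, transpose_apply, of_apply]
  split_ifs <;> first | (exfalso; omega) | simp

theorem stdJ_mul_self (n : ℕ) (hn : Even n) (R : Type*) [CommRing R] :
    stdJ n R * stdJ n R = -1 := by
  obtain ⟨m, rfl⟩ := hn
  ext i k
  have hi := i.isLt
  rw [mul_apply, neg_apply, one_apply]
  by_cases h : i.val < m
  · rw [Finset.sum_eq_single (⟨i + m, by omega⟩ : Fin (m + m))]
    · simp only [stdJ, of_apply, Fin.ext_iff]
      split_ifs <;> first | (exfalso; omega) | simp
    · intro b _ hb
      simp only [stdJ, of_apply, ne_eq, Fin.ext_iff] at hb ⊢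
      split_ifs <;> first | (exfalso; omega) | simp
    · simp
  · rw [Finset.sum_eq_single (⟨i - m, by omega⟩ : Fin (m + m))]
    · simp only [stdJ, of_apply, Fin.ext_iff]
      split_ifs <;> first | (exfalso; omega) | simp
    · intro b _ hb
      simp only [stdJ, of_apply, ne_eq, Fin.ext_iff] at hb ⊢
      split_ifs <;> first | (exfalso; omega) | simp
    · simp

theorem map_stdJ {R S : Type*} [CommRing R] [CommRing S] (f : R →+* S) (n : ℕ) :
    (stdJ n R).map f = stdJ n S := by
  ext i j
  simp only [stdJ, map_apply, of_apply]
  split_ifs <;> simp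

theorem dotProduct_mulVec_self_of_transpose_eq_neg {ι L : Type*} [Fintype ι] [Field L]
    (h2 : (2 : L) ≠ 0) {J : Matrix ι ι L} (hJ : Jᵀ = -J) (v : ι → L) : v ⬝ᵥ J *ᵥ v = 0 := by
  have h : v ⬝ᵥ J *ᵥ v = -(v ⬝ᵥ J *ᵥ v) := by
    conv_lhs => rw [dotProduct_mulVec, ← mulVec_transpose, hJ, neg_mulVec, neg_dotProduct,
      dotProduct_comm]
  have h' : 2 * (v ⬝ᵥ J *ᵥ v) = 0 := by linear_combination h
  exact (mul_eq_zero.mp h').resolve_left h2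

theorem vecMulVec_mul_mul_vecMulVec_self {ι L : Type*} [Fintype ι] [Field L]
    (h2 : (2 : L) ≠ 0) {J : Matrix ι ι L} (hJ : Jᵀ = -J) (v : ι → L) :
    vecMulVec v v * J * vecMulVec v v = 0 := by
  rw [vecMulVec_mul, vecMulVec_mul_vecMulVec, ← dotProduct_mulVec,
    dotProduct_mulVec_self_of_transpose_eq_neg h2 hJ, zero_smul, vecMulVec_zero]

/-- The symplectic transvection `x ↦ x + (vᵀ J x) v`. -/
def symplecticTransvection {ι L : Type*} [Fintype ι] [DecidableEq ι] [Field L]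
    (h2 : (2 : L) ≠ 0) {J : Matrix ι ι L} (hJ : Jᵀ = -J) (v : ι → L) : (Matrix ι ι L)ˣ where
  val := 1 + vecMulVec v v * J
  inv := 1 - vecMulVec v v * J
  val_inv := by
    have h : vecMulVec v v * J * (vecMulVec v v * J) = 0 := by
      rw [← mul_assoc, vecMulVec_mul_mul_vecMulVec_self h2 hJ, zero_mul]
    rw [mul_sub, mul_one, add_mul, one_mul, h]
    abel
  inv_val := by
    have h : vecMulVec v v * J * (vecMulVec v v * J) = 0 := by
      rw [← mul_assoc, vecMulVec_mul_mul_vecMulVec_self h2 hJ, zero_mul]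
    rw [mul_add, mul_one, sub_mul, one_mul, h]
    abel

theorem symplecticTransvection_preserves {ι L : Type*} [Fintype ι] [DecidableEq ι] [Field L]
    (h2 : (2 : L) ≠ 0) {J : Matrix ι ι L} (hJ : Jᵀ = -J) (v : ι → L) :
    (symplecticTransvection h2 hJ v : Matrix ι ι L)ᵀ * J * symplecticTransvection h2 hJ v = J := by
  have h := vecMulVec_mul_mul_vecMulVec_self h2 hJ v
  have h' : J * vecMulVec v v * J * vecMulVec v v * J = 0 := by
    rw [mul_assoc J, mul_assoc J, h, mul_zero, zero_mul]
  simp only [symplecticTransvection, transpose_add, transpose_mul, transpose_one,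
    transpose_vecMulVec, hJ]
  noncomm_ring
  simp only [← mul_assoc, h']
  simp

/-- Conjugating the transvection along `v` by a similitude `A` of multiplier `α` changes the
symmetric matrix `v vᵀ` into `α⁻¹ (A v) (A v)ᵀ`. -/
theorem conj_vecMulVec_mul {ι L : Type*} [Fintype ι] [DecidableEq ι] [Field L]
    {J : Matrix ι ι L} (A : (Matrix ι ι L)ˣ) {α : L} (hα : α ≠ 0)
    (hA : (A : Matrix ι ι L)ᵀ * J * A = α • J) (v : ι → L) :
    (A : Matrix ι ι L) * (vecMulVec v v * J) * (A⁻¹ : (Matrix ι ι L)ˣ) =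
      α⁻¹ • vecMulVec (A.val *ᵥ v) (A.val *ᵥ v) * J := by
  have h : J * (A⁻¹ : (Matrix ι ι L)ˣ).val = α⁻¹ • ((A : Matrix ι ι L)ᵀ * J) := by
    rw [Units.mul_inv_eq_iff_eq_mul, smul_mul_assoc, hA, smul_smul, inv_mul_cancel₀ hα, one_smul]
  rw [mul_assoc, mul_assoc, h, mul_smul_comm, mul_smul_comm, smul_mul_assoc, ← mul_assoc,
    ← mul_assoc, mul_vecMulVec, vecMulVec_mul, vecMul_transpose]

theorem inv_mul_mulVec_mul_mulVec_mem {K : Type*} [Field K] {n : ℕ} (hn : Even n)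
    (h2 : (2 : AlgebraicClosure K) ≠ 0)
    (A : (Matrix (Fin n) (Fin n) (AlgebraicClosure K))ˣ) {α : AlgebraicClosure K} (hα : α ≠ 0)
    (hA : (A : Matrix (Fin n) (Fin n) (AlgebraicClosure K))ᵀ * stdJ n (AlgebraicClosure K)
        * (A : Matrix (Fin n) (Fin n) (AlgebraicClosure K)) = α • stdJ n (AlgebraicClosure K))
    (hnorm : ∀ B ∈ SpOver K n, A * B * A⁻¹ ∈ SpOver K n)
    (v : Fin n → AlgebraicClosure K)
    (hv : ∀ i, v i ∈ (algebraMap K (AlgebraicClosure K)).range) (i j : Fin n) :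
    α⁻¹ * ((A.val *ᵥ v) i * (A.val *ᵥ v) j) ∈ (algebraMap K (AlgebraicClosure K)).range := by
  set S := (algebraMap K (AlgebraicClosure K)).range
  have hJ := stdJ_transpose n hn (AlgebraicClosure K)
  have one_mem (i j : Fin n) : (1 : Matrix (Fin n) (Fin n) (AlgebraicClosure K)) i j ∈ S :=
    S.matrix.one_mem i j
  have hT : symplecticTransvection h2 hJ v ∈ SpOver K n :=
    ⟨fun i j => S.add_mem (one_mem i j) (S.matrix.mul_mem
      (fun i j => S.mul_mem (hv i) (hv j)) (stdJ_apply_mem S) i j),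
      symplecticTransvection_preserves h2 hJ v⟩
  have hconj (i j : Fin n) :
      (α⁻¹ • vecMulVec (A.val *ᵥ v) (A.val *ᵥ v) * stdJ n (AlgebraicClosure K)) i j ∈ S := by
    have h := S.sub_mem ((hnorm _ hT).1 i j) (one_mem i j)
    rw [← conj_vecMulVec_mul A hα hA]
    convert h using 1
    simp [symplecticTransvection, mul_add, add_mul]
  have h := S.neg_mem (S.matrix.mul_mem hconj (stdJ_apply_mem S) i j)
  rw [mul_assoc, stdJ_mul_self n hn] at h
  simpa [vecMulVec_apply] using h

/-- If all `c (A v)ᵢ (A v)ⱼ` with `v` over a subfield of characteristic different from `2` lie in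
that subfield, then `A` is proportional to a matrix over the subfield. -/
theorem div_entry_mem_of_quadratic_mem {ι L : Type*} [Fintype ι] [DecidableEq ι] [Field L]
    (h2 : (2 : L) ≠ 0) (S : Subfield L) (A : Matrix ι ι L) {c : L} (hc : c ≠ 0)
    (h : ∀ v : ι → L, (∀ i, v i ∈ S) → ∀ i j, c * ((A *ᵥ v) i * (A *ᵥ v) j) ∈ S)
    {r s : ι} (hrs : A r s ≠ 0) (i j : ι) : (A r s)⁻¹ * A i j ∈ S := by
  have two_mem : (2 : L) ∈ S := by exact_mod_cast natCast_mem S 2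
  have single_mem (k l : ι) : (Pi.single k 1 : ι → L) l ∈ S := by
    rw [Pi.single_apply]
    split_ifs
    · exact S.one_mem
    · exact S.zero_mem
  have diag (i j k : ι) : c * (A i k * A j k) ∈ S := by
    simpa using h (Pi.single k 1) (single_mem k) i j
  have polar (i j k l : ι) : c * (A i k * A j l + A i l * A j k) ∈ S := by
    have := h (Pi.single k 1 + Pi.single l 1)
      (fun m => S.add_mem (single_mem k m) (single_mem l m)) i j
    simp only [mulVec_add, mulVec_single_one, Pi.add_apply, col_apply] at this
    convert S.sub_mem (S.sub_mem this (diag i j k)) (diag i j l) using 1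
    ring
  have row (l : ι) : c * (A r s * A r l) ∈ S := by
    convert S.div_mem (polar r r s l) two_mem using 1
    field_simp
    ring
  have key : c * (A r s * A i j) ∈ S := by
    convert S.sub_mem (polar r i s j)
      (S.div_mem (S.mul_mem (row j) (diag r i s)) (diag r r s)) using 1
    field_simp
    ring
  convert S.div_mem key (diag r r s) using 1
  field_simp

/-- For `K` a finite field of characteristic ≠ 2, every element of `GSp_n(K̄)`
normalising `Sp_n(K)` is a scalar multiple of a matrix in `GSp_n(K)`. -/
theorem normaliser_of_Sp_in_GSp
    {K : Type*} [Field K] [Fintype K] (hchar : ringChar K ≠ 2)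
    {n : ℕ} (hn2 : 2 ≤ n) (hneven : Even n)
    (A : (Matrix (Fin n) (Fin n) (AlgebraicClosure K))ˣ)
    (hA : ∃ α : (AlgebraicClosure K)ˣ,
      (A : Matrix (Fin n) (Fin n) (AlgebraicClosure K))ᵀ * stdJ n (AlgebraicClosure K)
        * (A : Matrix (Fin n) (Fin n) (AlgebraicClosure K))
        = (α : AlgebraicClosure K) • stdJ n (AlgebraicClosure K))
    (hnorm : (fun B => A * B * A⁻¹) '' SpOver K n = SpOver K n) :
    ∃ (lam : (AlgebraicClosure K)ˣ) (B : Matrix (Fin n) (Fin n) K),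
      (IsUnit B ∧ ∃ β : Kˣ, Bᵀ * stdJ n K * B = (β : K) • stdJ n K) ∧
      (A : Matrix (Fin n) (Fin n) (AlgebraicClosure K))
        = (lam : AlgebraicClosure K) • B.map (algebraMap K (AlgebraicClosure K)) := by
  obtain ⟨α, hα⟩ := hA
  have h2K : (2 : K) ≠ 0 := Ring.two_ne_zero hchar
  have h2 : (2 : AlgebraicClosure K) ≠ 0 := by
    rw [← map_ofNat (algebraMap K (AlgebraicClosure K)) 2]
    exact (map_ne_zero _).mpr h2K
  have hquad := inv_mul_mulVec_mul_mulVec_mem hneven h2 A α.ne_zero hα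
    fun B hB => hnorm ▸ Set.mem_image_of_mem _ hB
  have : Nonempty (Fin n) := ⟨⟨0, by omega⟩⟩
  obtain ⟨r, s, hrs⟩ : ∃ r s, A.val r s ≠ 0 := by
    by_contra! h
    exact A.ne_zero (Matrix.ext h)
  have hmem := div_entry_mem_of_quadratic_mem h2
    (algebraMap K (AlgebraicClosure K)).fieldRange A.val (inv_ne_zero α.ne_zero) hquad hrs
  choose b hb using hmem
  have hAB : A.val = A.val r s • (Matrix.of b).map (algebraMap K (AlgebraicClosure K)) := by
    ext i j
    simp [hb, hrs]
  have hunit : IsUnit (Matrix.of b) := by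
    rw [isUnit_iff_isUnit_det, isUnit_iff_ne_zero]
    intro h0
    have hdet := ((isUnit_iff_isUnit_det _).mp A.isUnit).ne_zero
    rw [hAB, det_smul, ← RingHom.mapMatrix_apply, ← RingHom.map_det, h0] at hdet
    simp at hdet
  obtain ⟨γ, hγ⟩ :
      (α.val)⁻¹ * (A.val r s * A.val r s) ∈ (algebraMap K (AlgebraicClosure K)).range := by
    simpa using hquad (Pi.single s 1) (fun i => by
      rw [Pi.single_apply]
      split_ifs
      · exact one_mem _
      · exact zero_mem _) r r
  have hγ0 : γ ≠ 0 := by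
    rintro rfl
    rw [map_zero] at hγ
    exact mul_ne_zero (inv_ne_zero α.ne_zero) (mul_ne_zero hrs hrs) hγ.symm
  refine ⟨Units.mk0 _ hrs, Matrix.of b, ⟨hunit, (Units.mk0 γ hγ0)⁻¹, ?_⟩, hAB⟩
  have hform : (A.val r s * A.val r s) • (((Matrix.of b).map (algebraMap K (AlgebraicClosure K)))ᵀ
      * stdJ n (AlgebraicClosure K) * (Matrix.of b).map (algebraMap K (AlgebraicClosure K)))
      = α.val • stdJ n (AlgebraicClosure K) := by
    rw [← hα]
    conv_rhs => rw [hAB]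
    simp [smul_smul]
  apply Matrix.map_injective (algebraMap K (AlgebraicClosure K)).injective
  dsimp only
  rw [Matrix.map_mul, Matrix.map_mul, map_stdJ, transpose_map]
  apply smul_right_injective _ (mul_ne_zero hrs hrs)
  refine hform.trans ?_
  ext i j
  have hα0 := α.ne_zero
  simp only [← map_stdJ (algebraMap K (AlgebraicClosure K)) n, Matrix.smul_apply, map_apply,
    smul_eq_mul, Units.val_inv_eq_inv_val, Units.val_mk0, map_mul, map_inv₀, hγ]
  field_simp
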